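/- Let Y1,…,Yl and G be jointly distributed finite-valued random variables. The following are equivalent: (a) there exist random variables Z1,…,Zl, U adjoinable to (Y1,…,Yl,G) such that H(U | (Z1,…,Zl)) = H((Z1,…,Zl) | U) = 0, G and U are both uniform with supports of equal cardinality, and for each i ∈ {1,…,l}: Yi and Zi are both uniform with supports of equal cardinality and I(Zi; (Z1,…,Z_{i−1})) = 0; (b) Y1,…,Yl and G are all uniform over their supports and |supp(G)| equals the product over i of |supp(Yi)|. -/

import Mathlib

namespace CIPaper

/-- A bundled probability space. -/
structure ProbSpace where
  carrier : Type
  [inst : MeasurableSpace carrier]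
  μ : MeasureTheory.Measure carrier
  [isProb : MeasureTheory.IsProbabilityMeasure μ]

attribute [instance] ProbSpace.inst ProbSpace.isProb

/-- A bundled finite measurable alphabet, used as value space of auxiliary random variables. -/
structure FinAlphabet where
  carrier : Type
  [fin : Fintype carrier]
  [ms : MeasurableSpace carrier]
  [msc : MeasurableSingletonClass carrier]

attribute [instance] FinAlphabet.fin FinAlphabet.ms FinAlphabet.msc

open MeasureTheory ProbabilityTheory Real

variable {Ω : Type*} [MeasurableSpace Ω] {S T U : Type*}

/-- P(X = x). -/
noncomputable def pr (μ : Measure Ω) (X : Ω → S) (x : S) : ℝ :=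
  (μ (X ⁻¹' {x})).toReal

/-- Shannon entropy (base 2) of a finite-valued random variable. -/
noncomputable def ent (μ : Measure Ω) [Fintype S] (X : Ω → S) : ℝ :=
  (∑ x, Real.negMulLog (pr μ X x)) / Real.log 2

/-- Conditional entropy H(X|Y). -/
noncomputable def condEnt (μ : Measure Ω) [Fintype S] [Fintype T]
    (X : Ω → S) (Y : Ω → T) : ℝ :=
  ent μ (fun ω => (X ω, Y ω)) - ent μ Y

/-- Mutual information I(X;Y). -/
noncomputable def mi (μ : Measure Ω) [Fintype S] [Fintype T]
    (X : Ω → S) (Y : Ω → T) : ℝ :=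
  ent μ X + ent μ Y - ent μ (fun ω => (X ω, Y ω))

/-- Conditional mutual information I(X;Y|Z). -/
noncomputable def cmi (μ : Measure Ω) [Fintype S] [Fintype T] [Fintype U]
    (X : Ω → S) (Y : Ω → T) (Z : Ω → U) : ℝ :=
  ent μ (fun ω => (X ω, Z ω)) + ent μ (fun ω => (Y ω, Z ω))
    - ent μ (fun ω => (X ω, (Y ω, Z ω))) - ent μ Z

/-- The support of a random variable: values of positive probability. -/
def support (μ : Measure Ω) (X : Ω → S) : Set S := {x | 0 < pr μ X x}

/-- X is uniformly distributed over its support. -/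
def IsUniform (μ : Measure Ω) (X : Ω → S) : Prop :=
  ∀ x ∈ support μ X, ∀ y ∈ support μ X, pr μ X x = pr μ X y

/-- X is uniformly distributed over a support of size n. -/
def UniformOn (μ : Measure Ω) (X : Ω → S) (n : ℕ) : Prop :=
  IsUniform μ X ∧ (support μ X).ncard = n

/-- The TRIPLE predicate: pairwise independence plus each variable a function of the
other two. -/
def TRIPLE (μ : Measure Ω) [Fintype S] [Fintype T] [Fintype U]
    (X : Ω → S) (Y : Ω → T) (Z : Ω → U) : Prop :=
  condEnt μ X (fun ω => (Y ω, Z ω)) = 0 ∧ condEnt μ Y (fun ω => (X ω, Z ω)) = 0 ∧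
    condEnt μ Z (fun ω => (X ω, Y ω)) = 0 ∧
    mi μ X Y = 0 ∧ mi μ X Z = 0 ∧ mi μ Y Z = 0

end CIPaper

namespace CIPaper

open MeasureTheory ProbabilityTheory Real

section Entropy

variable {Ω : Type*} [MeasurableSpace Ω] {S T U : Type*}

section ChainRule

variable {Ω' : Type*} [MeasurableSpace Ω'] {μ : Measure Ω} {ν : Measure Ω'}

lemma pr_nonneg (X : Ω → S) (x : S) : 0 ≤ pr μ X x := ENNReal.toReal_nonneg

lemma pr_eq_zero_of_notMem_support {X : Ω → S} {x : S} (hx : x ∉ support μ X) :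
    pr μ X x = 0 :=
  le_antisymm (not_lt.mp hx) (pr_nonneg X x)

lemma pr_comp_injective (X : Ω → S) {f : S → T} (hf : f.Injective) (x : S) :
    pr μ (fun ω => f (X ω)) (f x) = pr μ X x := by
  have h : (fun ω => f (X ω)) ⁻¹' {f x} = X ⁻¹' {x} := by
    ext ω
    simp [hf.eq_iff]
  rw [pr, pr, h]

/-- Entropy is invariant under injective relabelling. -/
lemma ent_comp_injective [Fintype S] [Fintype T] (X : Ω → S) {f : S → T} (hf : f.Injective) :
    ent μ (fun ω => f (X ω)) = ent μ X := by
  unfold ent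
  congr 1
  refine (Fintype.sum_of_injective f hf _ _ (fun y hy => ?_) (fun x => ?_)).symm
  · have h : (fun ω => f (X ω)) ⁻¹' {y} = ∅ := by
      ext ω
      simpa using fun h => hy ⟨X ω, h⟩
    simp [pr, h]
  · rw [pr_comp_injective X hf]

lemma ent_swap [Fintype S] [Fintype T] (X : Ω → S) (Y : Ω → T) :
    ent μ (fun ω => (Y ω, X ω)) = ent μ (fun ω => (X ω, Y ω)) :=
  ent_comp_injective (fun ω => (X ω, Y ω)) (f := Prod.swap) Prod.swap_injective

lemma pr_eq_of_identDistrib [MeasurableSpace S] [MeasurableSingletonClass S]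
    {X : Ω → S} {X' : Ω' → S} (h : IdentDistrib X X' μ ν) : pr μ X = pr ν X' := by
  ext x
  rw [pr, pr, h.measure_preimage_eq (measurableSet_singleton x)]

lemma support_congr {X : Ω → S} {X' : Ω' → S} (h : pr μ X = pr ν X') :
    support μ X = support ν X' := by
  simp only [support, h]

lemma isUniform_congr {X : Ω → S} {X' : Ω' → S} (h : pr μ X = pr ν X') :
    IsUniform μ X ↔ IsUniform ν X' := by
  simp only [IsUniform, support, h]

lemma pr_comp [IsFiniteMeasure μ] [Fintype S] [MeasurableSpace S] [MeasurableSingletonClass S]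
    [DecidableEq T] {X : Ω → S} (hX : Measurable X) (f : S → T) (y : T) :
    pr μ (fun ω => f (X ω)) y = ∑ x, if f x = y then pr μ X x else 0 := by
  have h : (fun ω => f (X ω)) ⁻¹' {y} = ⋃ x ∈ Finset.univ.filter (fun x => f x = y), X ⁻¹' {x} := by
    ext ω
    simp
  rw [← Finset.sum_filter, pr, h]
  refine measureReal_biUnion_finset (fun a _ b _ hab => ?_)
    (fun x _ => hX (measurableSet_singleton x))
  exact Disjoint.preimage X (Set.disjoint_singleton.mpr hab)

lemma sum_pr [IsProbabilityMeasure μ] [Fintype S] [MeasurableSpace S]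
    [MeasurableSingletonClass S] {X : Ω → S} (hX : Measurable X) : ∑ x, pr μ X x = 1 := by
  have h := pr_comp (μ := μ) hX (fun _ => ()) ()
  simpa [pr] using h.symm

lemma IsUniform.pr_eq [IsProbabilityMeasure μ] [Fintype S] [MeasurableSpace S]
    [MeasurableSingletonClass S] {X : Ω → S} (hX : Measurable X) (hu : IsUniform μ X)
    {x : S} (hx : x ∈ support μ X) : pr μ X x = ((support μ X).ncard : ℝ)⁻¹ := by
  classical
  have h1 : ∑ y, pr μ X y = (support μ X).ncard * pr μ X x := by
    have h2 : ∀ y, pr μ X y = if y ∈ support μ X then pr μ X x else 0 := fun y => by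
      split_ifs with hy
      · exact hu y hy x hx
      · exact pr_eq_zero_of_notMem_support hy
    rw [Finset.sum_congr rfl fun y _ => h2 y, ← Finset.sum_filter, Finset.sum_const, nsmul_eq_mul,
      Set.ncard_eq_toFinset_card', ← Set.filter_mem_univ_eq_toFinset]
  rw [sum_pr hX] at h1
  exact eq_inv_of_mul_eq_one_right h1.symm

lemma support_ncard_pos [IsProbabilityMeasure μ] [Fintype S] [MeasurableSpace S]
    [MeasurableSingletonClass S] {X : Ω → S} (hX : Measurable X) : 0 < (support μ X).ncard := by
  rw [Set.ncard_pos]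
  by_contra hne
  rw [Set.not_nonempty_iff_eq_empty] at hne
  have h := sum_pr (μ := μ) hX
  rw [Finset.sum_eq_zero fun x _ => pr_eq_zero_of_notMem_support (by simp [hne])] at h
  exact zero_ne_one h

lemma IsUniform.ent_eq [IsProbabilityMeasure μ] [Fintype S] [MeasurableSpace S]
    [MeasurableSingletonClass S] {X : Ω → S} (hX : Measurable X) (hu : IsUniform μ X) :
    ent μ X = Real.log (support μ X).ncard / Real.log 2 := by
  rw [ent]
  congr 1
  have h : ∀ x, Real.negMulLog (pr μ X x) = pr μ X x * Real.log (support μ X).ncard := fun x => by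
    by_cases hx : x ∈ support μ X
    · simp [hu.pr_eq hX hx, Real.negMulLog, Real.log_inv]
    · simp [pr_eq_zero_of_notMem_support hx]
  rw [Finset.sum_congr rfl fun x _ => h x, ← Finset.sum_mul, sum_pr hX, one_mul]

lemma ent_of_subsingleton [IsProbabilityMeasure μ] [Fintype S] [Subsingleton S] (X : Ω → S) :
    ent μ X = 0 := by
  have h : ∀ x, pr μ X x = 1 := fun x => by
    have : X ⁻¹' {x} = Set.univ := Set.eq_univ_of_forall fun ω => Subsingleton.elim _ _
    simp [pr, this]
  simp [ent, h]

/-- If each `Z i` is independent of the tuple of its predecessors, the entropy is additive. -/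
lemma ent_pi_eq_sum [IsProbabilityMeasure μ] {l : ℕ} {A : Fin l → Type*} [∀ i, Fintype (A i)]
    (Z : ∀ i, Ω → A i)
    (h : ∀ i, mi μ (Z i) (fun ω => fun j : {j : Fin l // j < i} => Z j.1 ω) = 0) :
    ent μ (fun ω => fun i => Z i ω) = ∑ i, ent μ (Z i) := by
  have key : ∀ n ≤ l, ent μ (fun ω => fun j : {j : Fin l // j.val < n} => Z j.1 ω) =
      ∑ j : Fin l with j.val < n, ent μ (Z j) := by
    intro n
    induction n with
    | zero =>
      intro _
      have : IsEmpty {j : Fin l // j.val < 0} := ⟨fun j => Nat.not_lt_zero _ j.2⟩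
      simp [ent_of_subsingleton]
    | succ n ih =>
      intro hn
      have hi := h ⟨n, hn⟩
      have hinj : Function.Injective
          (fun a : (∀ j : {j : Fin l // j.val < n + 1}, A j.1) =>
            (a ⟨⟨n, hn⟩, n.lt_succ_self⟩,
              fun j : {j : Fin l // j < ⟨n, hn⟩} => a ⟨j.1, Nat.lt_succ_of_lt j.2⟩)) := by
        intro a b hab
        rw [Prod.mk.injEq] at hab
        funext ⟨⟨j, hjl⟩, hj⟩
        rcases Nat.lt_succ_iff_lt_or_eq.mp hj with hj' | rfl
        · exact congrFun hab.2 ⟨⟨j, hjl⟩, hj'⟩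
        · exact hab.1
      have hjoint := ent_comp_injective (μ := μ)
        (fun ω => fun j : {j : Fin l // j.val < n + 1} => Z j.1 ω) hinj
      have hset : (Finset.univ.filter fun j : Fin l => j.val < n + 1) =
          insert ⟨n, hn⟩ (Finset.univ.filter fun j : Fin l => j.val < n) := by
        ext j
        simp [Fin.ext_iff]
        omega
      have hih : ent μ (fun ω => fun j : {j : Fin l // j < ⟨n, hn⟩} => Z j.1 ω) = _ :=
        ih (Nat.le_of_succ_le hn)
      rw [hset, Finset.sum_insert (by simp), ← hjoint, ← hih]
      unfold mi at hi
      linarith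
  have hinj : Function.Injective
      (fun (a : ∀ i, A i) (j : {j : Fin l // j.val < l}) => a j.1) :=
    fun a b hab => funext fun j => congrFun hab ⟨j, j.2⟩
  rw [← ent_comp_injective (fun ω => fun i => Z i ω) hinj, key l le_rfl]
  simp

end ChainRule

section FullUniform

variable {μ : Measure Ω}

lemma support_eq_univ_of_pr_eq_inv_card [Fintype S] {X : Ω → S}
    (h : ∀ x, pr μ X x = (Fintype.card S : ℝ)⁻¹) : support μ X = Set.univ := by
  refine Set.eq_univ_of_forall fun x => ?_
  have : 0 < Fintype.card S := Fintype.card_pos_iff.mpr ⟨x⟩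
  change 0 < pr μ X x
  rw [h]
  positivity

lemma ncard_support_of_pr_eq_inv_card [Fintype S] {X : Ω → S}
    (h : ∀ x, pr μ X x = (Fintype.card S : ℝ)⁻¹) : (support μ X).ncard = Fintype.card S := by
  rw [support_eq_univ_of_pr_eq_inv_card h, Set.ncard_univ, Nat.card_eq_fintype_card]

lemma isUniform_of_pr_eq_inv_card [Fintype S] {X : Ω → S}
    (h : ∀ x, pr μ X x = (Fintype.card S : ℝ)⁻¹) : IsUniform μ X :=
  fun x _ y _ => by rw [h, h]

variable [IsProbabilityMeasure μ]

lemma ent_of_pr_eq_inv_card [Fintype S] [MeasurableSpace S] [MeasurableSingletonClass S]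
    {X : Ω → S} (hX : Measurable X) (h : ∀ x, pr μ X x = (Fintype.card S : ℝ)⁻¹) :
    ent μ X = Real.log (Fintype.card S) / Real.log 2 := by
  rw [(isUniform_of_pr_eq_inv_card h).ent_eq hX, ncard_support_of_pr_eq_inv_card h]

/-- A coordinate of a uniform variable on a product is uniform. -/
lemma pr_fst_of_pr_eq_inv_card [Fintype S] [MeasurableSpace S] [MeasurableSingletonClass S]
    [Fintype T] [Fintype U] {X : Ω → S} (hX : Measurable X) (e : S ≃ T × U)
    (h : ∀ x, pr μ X x = (Fintype.card S : ℝ)⁻¹) (y : T) :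
    pr μ (fun ω => (e (X ω)).1) y = (Fintype.card T : ℝ)⁻¹ := by
  classical
  obtain ⟨ω⟩ : Nonempty Ω := nonempty_of_isProbabilityMeasure μ
  have : Nonempty U := ⟨(e (X ω)).2⟩
  have hU : (Fintype.card U : ℝ) ≠ 0 := by simp
  rw [pr_comp hX (fun x => (e x).1)]
  simp only [h]
  rw [e.sum_comp (fun z : T × U => if z.1 = y then (Fintype.card S : ℝ)⁻¹ else 0),
    Fintype.sum_prod_type_right, Fintype.card_congr e, Fintype.card_prod]
  simp [mul_comm (Fintype.card T : ℝ)]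
  field_simp

variable {ι : Type*} [Fintype ι] [DecidableEq ι] {A : ι → Type*} [∀ i, Fintype (A i)]
  [∀ i, MeasurableSpace (A i)] [∀ i, MeasurableSingletonClass (A i)]

lemma pr_apply_of_pr_eq_inv_card {X : Ω → ∀ i, A i} (hX : Measurable X)
    (h : ∀ x, pr μ X x = (Fintype.card (∀ i, A i) : ℝ)⁻¹) (i : ι) (a : A i) :
    pr μ (fun ω => X ω i) a = (Fintype.card (A i) : ℝ)⁻¹ :=
  pr_fst_of_pr_eq_inv_card hX (Equiv.piSplitAt i A) h a

lemma ent_restrict_of_pr_eq_inv_card {X : Ω → ∀ i, A i} (hX : Measurable X)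
    (h : ∀ x, pr μ X x = (Fintype.card (∀ i, A i) : ℝ)⁻¹) (p : ι → Prop) [DecidablePred p] :
    ent μ (fun ω => fun j : {j // p j} => X ω j.1) =
      Real.log (∏ j with p j, (Fintype.card (A j) : ℝ)) / Real.log 2 := by
  have hm : Measurable (fun ω => fun j : {j // p j} => X ω j.1) :=
    measurable_pi_lambda _ fun j => (measurable_pi_apply j.1).comp hX
  rw [ent_of_pr_eq_inv_card hm
    (fun y => pr_fst_of_pr_eq_inv_card hX (Equiv.piEquivPiSubtypeProd p A) h y), Fintype.card_pi,
    Finset.prod_subtype (p := p) _ (by simp)]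
  push_cast
  rfl

lemma mi_predecessors_of_pr_eq_inv_card [LinearOrder ι] {X : Ω → ∀ i, A i} (hX : Measurable X)
    (h : ∀ x, pr μ X x = (Fintype.card (∀ i, A i) : ℝ)⁻¹) (i : ι) :
    mi μ (fun ω => X ω i) (fun ω => fun j : {j // j < i} => X ω j.1) = 0 := by
  obtain ⟨ω⟩ : Nonempty Ω := nonempty_of_isProbabilityMeasure μ
  have hne : ∀ j, (Fintype.card (A j) : ℝ) ≠ 0 := fun j => by
    have : Nonempty (A j) := ⟨X ω j⟩
    simp
  have hinj : Function.Injective (fun a : (∀ j : {j // j ≤ i}, A j.1) =>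
      (a ⟨i, le_rfl⟩, fun j : {j // j < i} => a ⟨j.1, j.2.le⟩)) := by
    intro a b hab
    rw [Prod.mk.injEq] at hab
    funext ⟨j, hj⟩
    rcases hj.lt_or_eq with hj' | rfl
    · exact congrFun hab.2 ⟨j, hj'⟩
    · exact hab.1
  have hjoint := ent_comp_injective (μ := μ) (fun ω => fun j : {j // j ≤ i} => X ω j.1) hinj
  have hset : (Finset.univ.filter fun j => j ≤ i) =
      insert i (Finset.univ.filter fun j => j < i) := by
    ext j
    simp [le_iff_eq_or_lt]
  have hi : ent μ (fun ω => X ω i) = Real.log (Fintype.card (A i)) / Real.log 2 :=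
    ent_of_pr_eq_inv_card ((measurable_pi_apply i).comp hX) (pr_apply_of_pr_eq_inv_card hX h i)
  rw [mi, hjoint, hi, ent_restrict_of_pr_eq_inv_card hX h, ent_restrict_of_pr_eq_inv_card hX h,
    hset, Finset.prod_insert (by simp),
    Real.log_mul (hne i) (Finset.prod_ne_zero_iff.mpr fun j _ => hne j)]
  ring

end FullUniform

/-- A uniform variable can be relabelled to be uniform on any finite type as large as its
support. -/
lemma IsUniform.exists_comp_pr_eq_inv_card {μ : Measure Ω} [IsProbabilityMeasure μ] [Fintype S]
    [MeasurableSpace S] [MeasurableSingletonClass S] [Fintype T] {X : Ω → S} (hX : Measurable X)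
    (hu : IsUniform μ X) (hcard : (support μ X).ncard = Fintype.card T) :
    ∃ f : S → T, ∀ y, pr μ (fun ω => f (X ω)) y = (Fintype.card T : ℝ)⁻¹ := by
  classical
  have hpos : 0 < Fintype.card T := hcard ▸ support_ncard_pos hX
  obtain ⟨y₀⟩ : Nonempty T := Fintype.card_pos_iff.mp hpos
  have e : support μ X ≃ T := by
    refine Fintype.equivOfCardEq ?_
    rw [← hcard, ← Nat.card_coe_set_eq, Nat.card_eq_fintype_card]
  refine ⟨fun x => if hx : x ∈ support μ X then e ⟨x, hx⟩ else y₀, fun y => ?_⟩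
  rw [pr_comp hX (fun x => if hx : x ∈ support μ X then e ⟨x, hx⟩ else y₀),
    Finset.sum_eq_single (e.symm y).1, if_pos (by simp),
    hu.pr_eq hX (e.symm y).2, hcard]
  · intro x _ hxy
    by_cases hx : x ∈ support μ X
    · refine if_neg fun h => hxy ?_
      rw [dif_pos hx] at h
      rw [← h, e.symm_apply_apply]
    · rw [pr_eq_zero_of_notMem_support hx, ite_self]
  · simp

end Entropy

/-- the PROD characterization. -/
theorem stmt_13 {Ω : Type*} [MeasurableSpace Ω] (μ : Measure Ω) [IsProbabilityMeasure μ]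
    (l : ℕ) {SY : Fin l → Type*} {SG : Type*}
    [∀ i, Fintype (SY i)] [Fintype SG]
    [∀ i, MeasurableSpace (SY i)] [∀ i, MeasurableSingletonClass (SY i)]
    [MeasurableSpace SG] [MeasurableSingletonClass SG]
    (Y : (i : Fin l) → Ω → SY i) (G : Ω → SG)
    (hY : ∀ i, Measurable (Y i)) (hG : Measurable G) :
    (∃ (P : ProbSpace) (Y' : (i : Fin l) → P.carrier → SY i) (G' : P.carrier → SG)
      (ZT : Fin l → FinAlphabet) (UT : FinAlphabet)
      (Z : (i : Fin l) → P.carrier → (ZT i).carrier) (U : P.carrier → UT.carrier),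
      (∀ i, Measurable (Y' i)) ∧ Measurable G' ∧ (∀ i, Measurable (Z i)) ∧ Measurable U ∧
      IdentDistrib (fun ω => ((fun i => Y i ω), G ω))
        (fun ω => ((fun i => Y' i ω), G' ω)) μ P.μ ∧
      condEnt P.μ U (fun ω => fun i => Z i ω) = 0 ∧
      condEnt P.μ (fun ω => fun i => Z i ω) U = 0 ∧
      IsUniform P.μ G' ∧ IsUniform P.μ U ∧
      (support P.μ G').ncard = (support P.μ U).ncard ∧
      (∀ i, IsUniform P.μ (Y' i) ∧ IsUniform P.μ (Z i) ∧
        (support P.μ (Y' i)).ncard = (support P.μ (Z i)).ncard ∧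
        mi P.μ (Z i) (fun ω => fun j : {j : Fin l // j < i} => Z j.1 ω) = 0)) ↔
    ((∀ i, IsUniform μ (Y i)) ∧ IsUniform μ G ∧
      (support μ G).ncard = ∏ i, (support μ (Y i)).ncard) := by
  constructor
  · rintro ⟨P, Y', G', ZT, UT, Z, U, hY', hG', hZ, hU, hid, hUZ, hZU, hGu, hUu, hGU, hi⟩
    have hprY : ∀ i, pr μ (Y i) = pr P.μ (Y' i) := fun i =>
      pr_eq_of_identDistrib
        (hid.comp ((measurable_pi_apply i).comp measurable_fst))
    have hprG : pr μ G = pr P.μ G' := pr_eq_of_identDistrib (hid.comp measurable_snd)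
    refine ⟨fun i => (isUniform_congr (hprY i)).mpr (hi i).1, (isUniform_congr hprG).mpr hGu, ?_⟩
    have hent : ent P.μ U = ∑ i, ent P.μ (Z i) := by
      rw [← ent_pi_eq_sum Z fun i => (hi i).2.2.2]
      unfold condEnt at hUZ hZU
      rw [ent_swap] at hUZ
      linarith
    have hpos : ∀ i, ((support P.μ (Z i)).ncard : ℝ) ≠ 0 := fun i =>
      Nat.cast_ne_zero.mpr (support_ncard_pos (hZ i)).ne'
    have hlog2 : Real.log 2 ≠ 0 := (Real.log_pos one_lt_two).ne'
    rw [hUu.ent_eq hU, Finset.sum_congr rfl fun i _ => (hi i).2.1.ent_eq (hZ i),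
      ← Finset.sum_div, div_left_inj' hlog2, ← Real.log_prod fun i _ => hpos i] at hent
    have hprod : 0 < ∏ i, ((support P.μ (Z i)).ncard : ℝ) :=
      Finset.prod_pos fun i _ => Nat.cast_pos.mpr (support_ncard_pos (hZ i))
    have hcard : ((support P.μ U).ncard : ℝ) = ∏ i, ((support P.μ (Z i)).ncard : ℝ) :=
      Real.log_injOn_pos (Set.mem_Ioi.mpr (Nat.cast_pos.mpr (support_ncard_pos hU)))
        (Set.mem_Ioi.mpr hprod) hent
    rw [support_congr hprG, hGU, Finset.prod_congr rfl fun i _ =>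
      (congrArg Set.ncard (support_congr (hprY i))).trans (hi i).2.2.1]
    exact_mod_cast hcard
  · rintro ⟨hYu, hGu, hcard⟩
    let φ : ((∀ i, SY i) × SG) ≃ Fin (Fintype.card ((∀ i, SY i) × SG)) := Fintype.equivFin _
    have hYG : Measurable fun ω => ((fun i => Y i ω), G ω) :=
      (measurable_pi_lambda _ hY).prodMk hG
    have hφYG : Measurable fun ω => φ ((fun i => Y i ω), G ω) :=
      (Measurable.of_discrete (f := φ)).comp hYG
    let ν := μ.map fun ω => φ ((fun i => Y i ω), G ω)
    have : IsProbabilityMeasure ν := Measure.isProbabilityMeasure_map hφYG.aemeasurable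
    have hid : IdentDistrib (fun ω => ((fun i => Y i ω), G ω))
        (fun c => ((fun i => (φ.symm c).1 i), (φ.symm c).2)) μ ν := by
      refine ⟨hYG.aemeasurable, Measurable.of_discrete.aemeasurable, ?_⟩
      rw [Measure.map_map Measurable.of_discrete hφYG]
      simp [Function.comp_def]
    have hprY : ∀ i, pr μ (Y i) = pr ν (fun c => (φ.symm c).1 i) := fun i =>
      pr_eq_of_identDistrib (hid.comp ((measurable_pi_apply i).comp measurable_fst))
    have hprG : pr μ G = pr ν (fun c => (φ.symm c).2) :=
      pr_eq_of_identDistrib (hid.comp measurable_snd)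
    have hGu' := (isUniform_congr hprG).mp hGu
    have hcard' : (support ν (fun c => (φ.symm c).2)).ncard =
        Fintype.card (∀ i, Fin (support μ (Y i)).ncard) := by
      rw [← support_congr hprG, hcard]
      simp
    obtain ⟨f, hf⟩ := hGu'.exists_comp_pr_eq_inv_card Measurable.of_discrete hcard'
    have hfm : Measurable fun c => f (φ.symm c).2 := Measurable.of_discrete
    refine ⟨⟨_, ν⟩, fun i c => (φ.symm c).1 i, fun c => (φ.symm c).2,
      fun i => ⟨Fin (support μ (Y i)).ncard⟩, ⟨∀ i, Fin (support μ (Y i)).ncard⟩,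
      fun i c => f (φ.symm c).2 i, fun c => f (φ.symm c).2,
      fun i => Measurable.of_discrete, Measurable.of_discrete, fun i => Measurable.of_discrete,
      hfm, hid, ?_, ?_, hGu', isUniform_of_pr_eq_inv_card hf,
      hcard'.trans (ncard_support_of_pr_eq_inv_card hf).symm, fun i => ?_⟩
    · exact sub_eq_zero.mpr (ent_comp_injective (fun c => f (φ.symm c).2)
        (f := fun a => (a, a)) fun a b h => (Prod.mk.inj h).1)
    · exact sub_eq_zero.mpr (ent_comp_injective (fun c => f (φ.symm c).2)
        (f := fun a => (a, a)) fun a b h => (Prod.mk.inj h).1)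
    · have hZi := pr_apply_of_pr_eq_inv_card hfm hf i
      refine ⟨(isUniform_congr (hprY i)).mp (hYu i), isUniform_of_pr_eq_inv_card hZi, ?_,
        mi_predecessors_of_pr_eq_inv_card hfm hf i⟩
      refine Eq.trans ?_ (ncard_support_of_pr_eq_inv_card hZi).symm
      rw [Fintype.card_fin]
      exact congrArg Set.ncard (support_congr (hprY i)).symm

end CIPaper
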